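/- Let Ω and Ω_j (j ∈ ℕ) be nonempty bounded open subsets of ℝⁿ (n ≥ 2). If the characteristic functions χ_{Ω_j} converge to χ_Ω in L¹(ℝⁿ), then liminf_{j→∞} h(Ω_j) ≥ h(Ω). -/

import Mathlib

open MeasureTheory Metric Set Filter
open scoped ENNReal NNReal Topology Pointwise

noncomputable section

/-- The divergence of a vector field on `ℝⁿ`. -/
def divergence {n : ℕ} (g : EuclideanSpace ℝ (Fin n) → EuclideanSpace ℝ (Fin n))
    (x : EuclideanSpace ℝ (Fin n)) : ℝ :=
  LinearMap.trace ℝ (EuclideanSpace ℝ (Fin n)) (fderiv ℝ g x).toLinearMap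

/-- The (distributional) perimeter of a set `F ⊆ ℝⁿ`:
`P(F) = sup {∫_F div g : g ∈ C¹_c(ℝⁿ;ℝⁿ), ‖g‖ ≤ 1}`. -/
def perimeter {n : ℕ} (F : Set (EuclideanSpace ℝ (Fin n))) : ℝ≥0∞ :=
  ⨆ g ∈ {g : EuclideanSpace ℝ (Fin n) → EuclideanSpace ℝ (Fin n) |
      ContDiff ℝ 1 g ∧ HasCompactSupport g ∧ ∀ x, ‖g x‖ ≤ 1},
    ENNReal.ofReal (∫ x in F, divergence g x)

/-- The Cheeger constant of `Ω`:
`h(Ω) = inf {P(F) / |F| : F ⊆ Ω Borel, |F| > 0}`. -/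
def cheegerConstant {n : ℕ} (Ω : Set (EuclideanSpace ℝ (Fin n))) : ℝ≥0∞ :=
  ⨅ F ∈ {F : Set (EuclideanSpace ℝ (Fin n)) | MeasurableSet F ∧ F ⊆ Ω ∧ 0 < volume F},
    perimeter F / volume F

/-- `F` is a Cheeger set in `Ω`: a Borel subset of `Ω` of positive volume
whose ratio `P(F)/|F|` attains the Cheeger constant of `Ω`. -/
def IsCheegerSet {n : ℕ} (Ω F : Set (EuclideanSpace ℝ (Fin n))) : Prop :=
  MeasurableSet F ∧ F ⊆ Ω ∧ 0 < volume F ∧ perimeter F / volume F = cheegerConstant Ω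

open scoped symmDiff Manifold

/-- The divergence of a vector field of constant direction `v` is a derivative along `v`. -/
lemma divergence_smul_const {n : ℕ} {f : EuclideanSpace ℝ (Fin n) → ℝ}
    {x : EuclideanSpace ℝ (Fin n)} (hf : DifferentiableAt ℝ f x) (v : EuclideanSpace ℝ (Fin n)) :
    divergence (fun y => f y • v) x = fderiv ℝ f x v := by
  have : fderiv ℝ (fun y => f y • v) x = (fderiv ℝ f x).smulRight v :=
    (hf.hasFDerivAt.smul_const v).fderiv
  rw [divergence, this]
  exact LinearMap.trace_smulRight _ _

lemma divergence_const_smul {n : ℕ} {g : EuclideanSpace ℝ (Fin n) → EuclideanSpace ℝ (Fin n)}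
    {x : EuclideanSpace ℝ (Fin n)} (hg : DifferentiableAt ℝ g x) (c : ℝ) :
    divergence (fun y => c • g y) x = c * divergence g x := by
  have : fderiv ℝ (fun y => c • g y) x = c • fderiv ℝ g x := fderiv_fun_const_smul hg c
  simp [divergence, this]

lemma setIntegral_divergence_le_perimeter {n : ℕ} {F : Set (EuclideanSpace ℝ (Fin n))}
    (hP : perimeter F ≠ ∞) {g : EuclideanSpace ℝ (Fin n) → EuclideanSpace ℝ (Fin n)}
    (hg : ContDiff ℝ 1 g) (hgc : HasCompactSupport g) {M : ℝ} (hM : 0 ≤ M)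
    (hgM : ∀ x, ‖g x‖ ≤ M) :
    ∫ x in F, divergence g x ≤ M * (perimeter F).toReal := by
  obtain rfl | hM := hM.eq_or_lt
  · have : g = fun _ => 0 := funext fun x => norm_le_zero_iff.1 (hgM x)
    simp [this, divergence]
  have h : ENNReal.ofReal (∫ x in F, divergence (fun y => M⁻¹ • g y) x) ≤ perimeter F :=
    le_iSup₂ (f := fun g (_ : g ∈ {g : EuclideanSpace ℝ (Fin n) → EuclideanSpace ℝ (Fin n) |
      ContDiff ℝ 1 g ∧ HasCompactSupport g ∧ ∀ x, ‖g x‖ ≤ 1}) =>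
      ENNReal.ofReal (∫ x in F, divergence g x)) (fun y => M⁻¹ • g y)
      ⟨hg.const_smul _, hgc.smul_left (f := fun _ => M⁻¹), fun x => by
        rw [norm_smul, norm_inv, Real.norm_of_nonneg hM.le, inv_mul_le_one₀ hM]
        exact hgM x⟩
  rw [ENNReal.ofReal_le_iff_le_toReal hP] at h
  simp_rw [divergence_const_smul (hg.differentiable one_ne_zero _), integral_const_mul] at h
  rwa [inv_mul_le_iff₀ hM] at h

/-- Moving a compactly supported test function by `h` changes its integral over `F` by at most
`‖h‖ P(F)`. -/
lemma setIntegral_sub_translate_le {n : ℕ} {F : Set (EuclideanSpace ℝ (Fin n))}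
    (hF : volume F ≠ ∞) (hP : perimeter F ≠ ∞)
    {f : EuclideanSpace ℝ (Fin n) → ℝ} (hf : ContDiff ℝ 1 f) (hfc : HasCompactSupport f)
    (hf1 : ∀ x, ‖f x‖ ≤ 1) (h : EuclideanSpace ℝ (Fin n)) :
    (∫ x in F, f x) - ∫ x in F, f (x - h) ≤ ‖h‖ * (perimeter F).toReal := by
  have hdf : Continuous (fderiv ℝ f) := hf.continuous_fderiv one_ne_zero
  obtain ⟨C, hC⟩ := (hfc.fderiv (𝕜 := ℝ)).exists_bound_of_continuous hdf
  have : IsFiniteMeasure (volume.restrict F) := ⟨by simpa using hF.lt_top⟩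
  have hder (t : ℝ) : HasDerivAt (fun s : ℝ => ∫ x in F, f (x + (s - 1) • h))
      (∫ x in F, fderiv ℝ f (x + (t - 1) • h) h) t := by
    refine (hasDerivAt_integral_of_dominated_loc_of_deriv_le (s := univ) (bound := fun _ => C * ‖h‖)
      (F := fun (s : ℝ) x => f (x + (s - 1) • h))
      (F' := fun (s : ℝ) x => fderiv ℝ f (x + (s - 1) • h) h)
      univ_mem ?_ ?_ ?_ ?_ (integrable_const _) ?_).2
    · exact .of_forall fun s => (hf.continuous.comp (by fun_prop)).aestronglyMeasurable
    · refine Integrable.of_bound (hf.continuous.comp (by fun_prop)).aestronglyMeasurable 1 ?_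
      exact .of_forall fun x => hf1 _
    · exact ((hdf.comp (by fun_prop)).clm_apply continuous_const).aestronglyMeasurable
    · exact .of_forall fun x s _ => ((fderiv ℝ f _).le_opNorm h).trans (by gcongr; exact hC _)
    · refine .of_forall fun x s _ => ?_
      have h1 : HasDerivAt (fun s : ℝ => x + (s - 1) • h) h s := by
        simpa using (((hasDerivAt_id s).sub_const 1).smul_const h).const_add x
      exact (hf.differentiable one_ne_zero _).hasFDerivAt.comp_hasDerivAt s h1
  have hle (t : ℝ) : ∫ x in F, fderiv ℝ f (x + (t - 1) • h) h ≤ ‖h‖ * (perimeter F).toReal := by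
    have hft : ContDiff ℝ 1 fun x => f (x + (t - 1) • h) := hf.comp (by fun_prop)
    have heq (x) : divergence (fun y => f (y + (t - 1) • h) • h) x
        = fderiv ℝ f (x + (t - 1) • h) h := by
      rw [divergence_smul_const (hft.differentiable one_ne_zero x), fderiv_comp_add_right]
    simp_rw [← heq]
    refine setIntegral_divergence_le_perimeter hP (hft.smul contDiff_const) ?_ (norm_nonneg h) ?_
    · exact (hfc.comp_homeomorph (Homeomorph.addRight ((t - 1) • h))).smul_right
        (f' := fun _ => h)
    · intro x
      exact (norm_smul _ _).trans_le (mul_le_of_le_one_left (norm_nonneg h) (hf1 _))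
  have := image_sub_le_mul_sub_of_deriv_le (f := fun s : ℝ => ∫ x in F, f (x + (s - 1) • h))
    (fun t => (hder t).differentiableAt) (fun t => (hder t).deriv.trans_le (hle t)) zero_le_one
  simpa only [sub_self, zero_smul, add_zero, zero_sub, neg_smul, one_smul, ← sub_eq_add_neg,
    sub_zero, mul_one] using this

/-- The part of `F` which leaves `F` under translation by `h` has volume at most `‖h‖ P(F)`. -/
lemma volume_diff_translate_le {n : ℕ} {F : Set (EuclideanSpace ℝ (Fin n))}
    (hFm : MeasurableSet F) (hF : volume F ≠ ∞) (hP : perimeter F ≠ ∞)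
    (h : EuclideanSpace ℝ (Fin n)) :
    volume (F \ (fun x => x + h) ⁻¹' F) ≤ ENNReal.ofReal ‖h‖ * perimeter F := by
  set G := (fun x => x + h) ⁻¹' F
  have hGm : MeasurableSet G := (measurable_add_const h) hFm
  have hA : volume (F \ G) ≠ ∞ := measure_ne_top_of_subset sdiff_subset hF
  refine ENNReal.le_of_forall_pos_le_add fun ε hε _ => ?_
  obtain ⟨K, hKA, hK, hAK⟩ := (hFm.diff hGm).exists_isCompact_sdiff_lt hA
    (ε := (ε / 2 : ℝ≥0)) (by positivity)
  obtain ⟨U, hKU, hU, hUK⟩ := K.exists_isOpen_lt_add (μ := volume) hK.measure_ne_top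
    (ε := (ε / 2 : ℝ≥0)) (by positivity)
  obtain ⟨f, hf, hf01, hfU, hfK⟩ := exists_contMDiff_support_eq_eq_one_iff
    𝓘(ℝ, EuclideanSpace ℝ (Fin n)) (n := 1) (hU.inter (isOpen_thickening (δ := 1) (E := K)))
    hK.isClosed (subset_inter hKU (self_subset_thickening one_pos K))
  replace hf := hf.contDiff
  have hf01 (x) : 0 ≤ f x ∧ f x ≤ 1 := hf01 (mem_range_self x)
  have hfc : HasCompactSupport f := by
    refine HasCompactSupport.intro (hK.isBounded.thickening (δ := 1)).isCompact_closure
      fun x hx => ?_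
    by_contra hne
    have : x ∈ U ∩ thickening 1 K := hfU ▸ hne
    exact hx (subset_closure this.2)
  have hfi : Integrable f := hf.continuous.integrable_of_hasCompactSupport hfc
  have key := setIntegral_sub_translate_le hF hP hf hfc
    (fun x => by rw [Real.norm_of_nonneg (hf01 x).1]; exact (hf01 x).2) h
  have hshift : ∫ x in F, f (x - h) = ∫ x in G, f x := by
    have := (measurePreserving_add_right (volume : Measure (EuclideanSpace ℝ (Fin n)))
      h).setIntegral_preimage_emb (measurableEmbedding_addRight h) (fun x => f (x - h)) F
    simpa using this.symm
  have h1 : volume.real K ≤ ∫ x in F \ G, f x := by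
    calc volume.real K = ∫ x in K, (1 : ℝ) := by simp
      _ = ∫ x in K, f x := setIntegral_congr_fun hK.measurableSet fun x hx => ((hfK x).1 hx).symm
      _ ≤ ∫ x in F \ G, f x := setIntegral_mono_set hfi.integrableOn
          (.of_forall fun x => (hf01 x).1) hKA.eventuallyLE
  have hUfin : volume U ≠ ∞ :=
    (hUK.trans (ENNReal.add_lt_top.2 ⟨hK.measure_lt_top, ENNReal.coe_lt_top⟩)).ne
  have hUKfin : volume (U \ K) ≠ ∞ := measure_ne_top_of_subset sdiff_subset hUfin
  have h2 : ∫ x in G \ F, f x ≤ volume.real (U \ K) := by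
    calc ∫ x in G \ F, f x ≤ ∫ x in G \ F, (U \ K).indicator (fun _ => (1 : ℝ)) x := by
          refine setIntegral_mono_on hfi.integrableOn ?_ (hGm.diff hFm) fun x hx => ?_
          · exact ((integrable_indicator_iff (hU.measurableSet.diff hK.measurableSet)).2
              (integrableOn_const hUKfin)).integrableOn
          · by_cases hxU : x ∈ U
            · have hxK : x ∉ K := fun hxK => hx.2 (hKA hxK).1
              rw [indicator_of_mem (s := U \ K) ⟨hxU, hxK⟩]
              exact (hf01 x).2
            · have : f x = 0 := by
                by_contra hne
                have : x ∈ U ∩ thickening 1 K := hfU ▸ hne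
                exact hxU this.1
              rw [this]
              exact indicator_nonneg (fun _ _ => zero_le_one) x
      _ ≤ ∫ x, (U \ K).indicator (fun _ => (1 : ℝ)) x := by
          refine setIntegral_le_integral ?_ (.of_forall fun x =>
            indicator_nonneg (fun _ _ => zero_le_one) x)
          exact (integrable_indicator_iff (hU.measurableSet.diff hK.measurableSet)).2
              (integrableOn_const hUKfin)
      _ = volume.real (U \ K) := by
          rw [integral_indicator (hU.measurableSet.diff hK.measurableSet)]; simp
  have h3 : (∫ x in F, f x) - ∫ x in G, f x = (∫ x in F \ G, f x) - ∫ x in G \ F, f x := by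
    rw [← integral_inter_add_sdiff (s := F) hGm hfi.integrableOn,
      ← integral_inter_add_sdiff (s := G) hFm hfi.integrableOn, inter_comm]
    ring
  rw [hshift, h3] at key
  have h4 : volume.real (U \ K) ≤ ε / 2 := by
    have : volume (U \ K) ≤ (ε / 2 : ℝ≥0) := by
      rw [measure_sdiff hKU hK.measurableSet.nullMeasurableSet hK.measure_ne_top]
      exact tsub_le_iff_left.2 hUK.le
    exact ENNReal.toReal_mono ENNReal.coe_ne_top this
  have h5 : volume.real K ≤ ‖h‖ * (perimeter F).toReal + ε / 2 := by linarith
  calc volume (F \ G) ≤ volume K + volume ((F \ G) \ K) := by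
        rw [add_comm]; exact (measure_mono (by rw [sdiff_union_self]; exact subset_union_left)).trans
          (measure_union_le _ _)
    _ ≤ (ENNReal.ofReal ‖h‖ * perimeter F + (ε / 2 : ℝ≥0)) + (ε / 2 : ℝ≥0) := by
        refine add_le_add ?_ hAK.le
        rw [← ofReal_measureReal hK.measure_ne_top, ← ENNReal.ofReal_toReal hP,
          ← ENNReal.ofReal_mul (norm_nonneg h), ← ENNReal.ofReal_coe_nnreal,
          ← ENNReal.ofReal_add (by positivity) (by positivity)]
        exact ENNReal.ofReal_le_ofReal (by simpa using h5)
    _ = _ := by rw [add_assoc, ← ENNReal.coe_add, add_halves]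

lemma lintegral_volume_not_mem_le {n : ℕ} {F A : Set (EuclideanSpace ℝ (Fin n))}
    (hFm : MeasurableSet F) (hF : volume F ≠ ∞) (hP : perimeter F ≠ ∞) (hA : MeasurableSet A)
    {r : ℝ} (hAr : ∀ y ∈ A, ‖y‖ ≤ r) :
    ∫⁻ x in F, volume {y ∈ A | x + y ∉ F} ≤ volume A * (ENNReal.ofReal r * perimeter F) := by
  let S : Set (EuclideanSpace ℝ (Fin n) × EuclideanSpace ℝ (Fin n)) :=
    {p | p.2 ∈ A ∧ p.1 + p.2 ∉ F}
  have hS : MeasurableSet S :=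
    (measurable_snd hA).inter ((measurable_fst.add measurable_snd) hFm.compl)
  calc ∫⁻ x in F, volume {y ∈ A | x + y ∉ F} = ((volume.restrict F).prod volume) S :=
        (Measure.prod_apply hS).symm
    _ = ∫⁻ y, volume.restrict F ((fun x => (x, y)) ⁻¹' S) := Measure.prod_apply_symm hS
    _ ≤ ∫⁻ y, A.indicator (fun _ => ENNReal.ofReal r * perimeter F) y := by
        refine lintegral_mono fun y => ?_
        by_cases hy : y ∈ A
        · rw [indicator_of_mem hy, Measure.restrict_apply (measurable_prodMk_right hS)]
          refine (measure_mono ?_).trans ((volume_diff_translate_le hFm hF hP y).trans ?_)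
          · exact fun x hx => ⟨hx.2, hx.1.2⟩
          · gcongr; exact hAr y hy
        · have : (fun x => (x, y)) ⁻¹' S = ∅ := by
            ext x; simp [S, hy]
          simp [this]
    _ = volume A * (ENNReal.ofReal r * perimeter F) := by
        rw [lintegral_indicator_const hA, mul_comm]

lemma lintegral_compl_volume_mem_le {n : ℕ} {F A : Set (EuclideanSpace ℝ (Fin n))}
    (hFm : MeasurableSet F) (hF : volume F ≠ ∞) (hP : perimeter F ≠ ∞) (hA : MeasurableSet A)
    {r : ℝ} (hAr : ∀ y ∈ A, ‖y‖ ≤ r) :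
    ∫⁻ x in Fᶜ, volume {y ∈ A | x + y ∈ F} ≤ volume A * (ENNReal.ofReal r * perimeter F) := by
  let S : Set (EuclideanSpace ℝ (Fin n) × EuclideanSpace ℝ (Fin n)) :=
    {p | p.2 ∈ A ∧ p.1 + p.2 ∈ F}
  have hS : MeasurableSet S :=
    (measurable_snd hA).inter ((measurable_fst.add measurable_snd) hFm)
  calc ∫⁻ x in Fᶜ, volume {y ∈ A | x + y ∈ F} = ((volume.restrict Fᶜ).prod volume) S :=
        (Measure.prod_apply hS).symm
    _ = ∫⁻ y, volume.restrict Fᶜ ((fun x => (x, y)) ⁻¹' S) := Measure.prod_apply_symm hS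
    _ ≤ ∫⁻ y, A.indicator (fun _ => ENNReal.ofReal r * perimeter F) y := by
        refine lintegral_mono fun y => ?_
        by_cases hy : y ∈ A
        · rw [indicator_of_mem hy, Measure.restrict_apply (measurable_prodMk_right hS)]
          calc volume ((fun x => (x, y)) ⁻¹' S ∩ Fᶜ)
              ≤ volume ((fun x => x + y) ⁻¹' (F \ (fun x => x + -y) ⁻¹' F)) :=
                measure_mono fun x hx => ⟨hx.1.2, by simpa using hx.2⟩
            _ = volume (F \ (fun x => x + -y) ⁻¹' F) := measure_preimage_add_right _ _ _
            _ ≤ ENNReal.ofReal ‖-y‖ * perimeter F := volume_diff_translate_le hFm hF hP (-y)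
            _ ≤ ENNReal.ofReal r * perimeter F := by gcongr; simpa using hAr y hy
        · have : (fun x => (x, y)) ⁻¹' S = ∅ := by
            ext x; simp [S, hy]
          simp [this]
    _ = volume A * (ENNReal.ofReal r * perimeter F) := by
        rw [lintegral_indicator_const hA, mul_comm]

lemma volume_sep_add_volume_sep {n : ℕ} {F A : Set (EuclideanSpace ℝ (Fin n))}
    (hFm : MeasurableSet F) (x : EuclideanSpace ℝ (Fin n)) :
    volume {y ∈ A | x + y ∈ F} + volume {y ∈ A | x + y ∉ F} = volume A :=
  measure_inter_add_sdiff A ((measurable_const_add x) hFm)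

lemma measurable_volume_sep {n : ℕ} {F A : Set (EuclideanSpace ℝ (Fin n))}
    (hFm : MeasurableSet F) (hA : MeasurableSet A) :
    Measurable fun x => volume {y ∈ A | x + y ∈ F} :=
  measurable_measure_prodMk_left (s := {p | p.2 ∈ A ∧ p.1 + p.2 ∈ F})
    ((measurable_snd hA).inter ((measurable_fst.add measurable_snd) hFm))

/-- Sets of small volume have large perimeter. -/
lemma volume_le_mul_perimeter {n : ℕ} {F : Set (EuclideanSpace ℝ (Fin n))}
    (hFm : MeasurableSet F) (hP : perimeter F ≠ ∞) {r : ℝ} (hr : 0 < r)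
    (hFr : volume F ≤ volume (ball (0 : EuclideanSpace ℝ (Fin n)) r) / 2) :
    volume F ≤ 2 * (ENNReal.ofReal r * perimeter F) := by
  set A := ball (0 : EuclideanSpace ℝ (Fin n)) r
  have hA0 : volume A ≠ 0 := (measure_ball_pos _ _ hr).ne'
  have hAt : volume A ≠ ∞ := measure_ball_lt_top.ne
  have hF : volume F ≠ ∞ := ne_top_of_le_ne_top (ENNReal.div_ne_top hAt two_ne_zero) hFr
  have hx (x) : volume A / 2 ≤ volume {y ∈ A | x + y ∉ F} := by
    have h1 : volume {y ∈ A | x + y ∈ F} ≤ volume A / 2 := by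
      refine le_trans ?_ hFr
      rw [← measure_preimage_add volume x F]
      exact measure_mono fun y hy => hy.2
    have h2 := volume_sep_add_volume_sep (A := A) hFm x
    rw [← ENNReal.sub_half hAt, tsub_le_iff_left, ← h2]
    gcongr
    rwa [h2]
  have key := lintegral_volume_not_mem_le hFm hF hP measurableSet_ball
    (A := A) (r := r) fun y hy => (mem_ball_zero_iff.1 hy).le
  have h3 : volume A / 2 * volume F ≤ volume A * (ENNReal.ofReal r * perimeter F) := by
    refine le_trans ?_ key
    rw [← setLIntegral_const]
    exact lintegral_mono hx
  have h4 : volume A * volume F ≤ volume A * (2 * (ENNReal.ofReal r * perimeter F)) := by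
    calc volume A * volume F = 2 * (volume A / 2 * volume F) := by
          rw [← mul_assoc, ENNReal.mul_div_cancel two_ne_zero ENNReal.ofNat_ne_top]
      _ ≤ 2 * (volume A * (ENNReal.ofReal r * perimeter F)) := by gcongr
      _ = _ := by ring
  rwa [ENNReal.mul_le_mul_iff_right hA0 hAt] at h4

/-- The volume of `F \ G` is controlled by the perimeters of `F` and `G` and by the difference of
the averages of their characteristic functions at scale `r`. -/
lemma volume_mul_volume_diff_le {n : ℕ} {F G A : Set (EuclideanSpace ℝ (Fin n))}
    (hFm : MeasurableSet F) (hF : volume F ≠ ∞) (hPF : perimeter F ≠ ∞)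
    (hGm : MeasurableSet G) (hG : volume G ≠ ∞) (hPG : perimeter G ≠ ∞) (hA : MeasurableSet A)
    {r : ℝ} (hAr : ∀ y ∈ A, ‖y‖ ≤ r) :
    volume A * volume (F \ G) ≤ volume A * (ENNReal.ofReal r * perimeter F) +
      volume A * (ENNReal.ofReal r * perimeter G) +
      ∫⁻ x in F, (volume {y ∈ A | x + y ∈ F} - volume {y ∈ A | x + y ∈ G}) := by
  calc volume A * volume (F \ G) = ∫⁻ x in F \ G, volume A := (setLIntegral_const _ _).symm
    _ ≤ ∫⁻ x in F \ G, (volume {y ∈ A | x + y ∉ F} + (volume {y ∈ A | x + y ∈ G} +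
          (volume {y ∈ A | x + y ∈ F} - volume {y ∈ A | x + y ∈ G}))) := by
        refine lintegral_mono fun x => ?_
        rw [← volume_sep_add_volume_sep (A := A) hFm x, add_comm]
        gcongr
        exact le_add_tsub
    _ = (∫⁻ x in F \ G, volume {y ∈ A | x + y ∉ F}) +
          ((∫⁻ x in F \ G, volume {y ∈ A | x + y ∈ G}) +
          ∫⁻ x in F \ G, (volume {y ∈ A | x + y ∈ F} - volume {y ∈ A | x + y ∈ G})) := by
        rw [← lintegral_add_left (measurable_volume_sep hGm hA)]
        exact lintegral_add_left (measurable_volume_sep hFm.compl hA) _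
    _ ≤ (∫⁻ x in F, volume {y ∈ A | x + y ∉ F}) + ((∫⁻ x in Gᶜ, volume {y ∈ A | x + y ∈ G}) +
          ∫⁻ x in F, (volume {y ∈ A | x + y ∈ F} - volume {y ∈ A | x + y ∈ G})) :=
        add_le_add (lintegral_mono_set sdiff_subset)
          (add_le_add (lintegral_mono_set fun x hx => hx.2) (lintegral_mono_set sdiff_subset))
    _ ≤ _ := by
        rw [← add_assoc]
        gcongr
        · exact lintegral_volume_not_mem_le hFm hF hPF hA hAr
        · exact lintegral_compl_volume_mem_le hGm hG hPG hA hAr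

/-- A bounded sequence of sets has a subsequence along which the measures of the intersections
with all sets of finite measure converge. -/
lemma exists_subseq_tendsto_measure_inter {α : Type*} [MeasurableSpace α] {μ : Measure α}
    [IsSeparable μ] {F : ℕ → Set α} (hFm : ∀ j, MeasurableSet (F j)) {M : ℝ≥0∞} (hM : M ≠ ∞)
    (hFM : ∀ j, μ (F j) ≤ M) :
    ∃ φ : ℕ → ℕ, StrictMono φ ∧ ∀ B, MeasurableSet B → μ B ≠ ∞ →
      ∃ l, Tendsto (fun j => μ (F (φ j) ∩ B)) atTop (𝓝 l) := by
  have hF (j) : μ (F j) ≠ ∞ := ne_top_of_le_ne_top hM (hFM j)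
  let u (j : ℕ) : Lp ℝ 2 μ := indicatorConstLp 2 (hFm j) (hF j) 1
  let f (j : ℕ) : WeakDual ℝ (Lp ℝ 2 μ) :=
    StrongDual.toWeakDual (InnerProductSpace.toDual ℝ (Lp ℝ 2 μ) (u j))
  have hf (j : ℕ) : f j ∈ WeakDual.toStrongDual ⁻¹'
      closedBall (0 : StrongDual ℝ (Lp ℝ 2 μ)) (M.toReal ^ (1 / 2 : ℝ)) := by
    rw [mem_preimage, mem_closedBall_zero_iff]
    change ‖InnerProductSpace.toDual ℝ (Lp ℝ 2 μ) (u j)‖ ≤ _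
    rw [LinearIsometryEquiv.norm_map, norm_indicatorConstLp two_ne_zero ENNReal.ofNat_ne_top]
    simp only [norm_one, one_mul, ENNReal.toReal_ofNat]
    gcongr
    exact ENNReal.toReal_mono hM (hFM j)
  have : Fact ((2 : ℝ≥0∞) ≠ ∞) := ⟨ENNReal.ofNat_ne_top⟩
  obtain ⟨L, -, φ, hφ, hL⟩ := WeakDual.isSeqCompact_closedBall ℝ (Lp ℝ 2 μ) 0 _ hf
  refine ⟨φ, hφ, fun B hB hBt => ⟨ENNReal.ofReal (L (indicatorConstLp 2 hB hBt 1)), ?_⟩⟩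
  have h1 := ((WeakBilin.eval_continuous _ (indicatorConstLp 2 hB hBt (1 : ℝ))).tendsto L).comp hL
  refine (ENNReal.tendsto_ofReal h1).congr fun j => ?_
  change ENNReal.ofReal (inner ℝ (u (φ j)) (indicatorConstLp 2 hB hBt (1 : ℝ))) = _
  rw [L2.real_inner_indicatorConstLp_one_indicatorConstLp_one (hFm _) hB (hF _) hBt,
    ofReal_measureReal (measure_ne_top_of_subset inter_subset_left (hF _))]

/-- A sequence of sets which is Cauchy in measure has a subsequence converging in measure. -/
lemma exists_subseq_tendsto_measure_symmDiff {α : Type*} [MeasurableSpace α] {μ : Measure α}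
    {F : ℕ → Set α} (hFm : ∀ j, MeasurableSet (F j))
    (hF : ∀ ε : ℝ≥0∞, ε ≠ 0 → ∃ N, ∀ j ≥ N, ∀ k ≥ N, μ (F j \ F k) ≤ ε) :
    ∃ φ : ℕ → ℕ, StrictMono φ ∧ ∃ G, MeasurableSet G ∧
      Tendsto (fun j => μ (F (φ j) ∆ G)) atTop (𝓝 0) := by
  have hF' (k : ℕ) : ∃ N, ∀ i ≥ N, ∀ j ≥ i, μ (F i ∆ F j) ≤ (2⁻¹ : ℝ≥0∞) ^ k := by
    obtain ⟨N, hN⟩ := hF ((2⁻¹ : ℝ≥0∞) ^ k / 2) (by simp)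
    refine ⟨N, fun i hi j hj => (measure_union_le _ _).trans ?_⟩
    rw [← ENNReal.add_halves ((2⁻¹ : ℝ≥0∞) ^ k)]
    exact add_le_add (hN i hi j (hi.trans hj)) (hN j (hi.trans hj) i hi)
  obtain ⟨φ, hφ, hφF⟩ := extraction_forall_of_eventually' hF'
  let D (k : ℕ) : Set α := F (φ k) ∆ F (φ (k + 1))
  have hD (k : ℕ) : μ (D k) ≤ (2⁻¹ : ℝ≥0∞) ^ k := hφF k _ (hφ k.lt_succ_self).le
  let G : Set α := ⋂ N, ⋃ k ≥ N, F (φ k)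
  have hmono {x : α} {k m : ℕ} (hkm : k ≤ m) (hx : x ∉ ⋃ i ≥ k, D i) :
      x ∈ F (φ k) ↔ x ∈ F (φ m) := by
    induction m, hkm using Nat.le_induction with
    | base => rfl
    | succ m hm ih =>
      have : x ∉ D m := fun h => hx (mem_biUnion (show m ∈ {i | i ≥ k} from hm) h)
      rw [ih]
      by_contra! hne
      exact this (by simp only [D, mem_symmDiff]; tauto)
  have hsub (k : ℕ) : F (φ k) ∆ G ⊆ ⋃ i ≥ k, D i := by
    intro x hx
    by_contra hxD
    have h1 : x ∈ G ↔ x ∈ F (φ k) := by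
      simp only [G, mem_iInter, mem_iUnion]
      constructor
      · intro h
        obtain ⟨m, hm, hxm⟩ := h k
        exact (hmono hm hxD).2 hxm
      · exact fun h N => ⟨max k N, le_max_right _ _, (hmono (le_max_left _ _) hxD).1 h⟩
    simp only [mem_symmDiff] at hx
    tauto
  refine ⟨φ, hφ, G, .iInter fun N => .iUnion fun k => .iUnion fun _ => hFm _, ?_⟩
  have hle (k : ℕ) : μ (F (φ k) ∆ G) ≤ ∑' i, (2⁻¹ : ℝ≥0∞) ^ (i + k) := by
    calc μ (F (φ k) ∆ G) ≤ μ (⋃ i, D (i + k)) := by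
          refine measure_mono ((hsub k).trans fun x hx => ?_)
          obtain ⟨i, hi, hx⟩ := mem_iUnion₂.1 hx
          exact mem_iUnion.2 ⟨i - k, by rwa [Nat.sub_add_cancel hi]⟩
      _ ≤ ∑' i, μ (D (i + k)) := measure_iUnion_le _
      _ ≤ _ := ENNReal.tsum_le_tsum fun i => hD _
  refine tendsto_of_tendsto_of_tendsto_of_le_of_le tendsto_const_nhds ?_ (fun _ => zero_le) hle
  exact ENNReal.tendsto_sum_nat_add _ (by simp [ENNReal.tsum_geometric])

/-- Compactness of sets of uniformly bounded perimeter whose mass does not escape from a fixed set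
of finite volume. -/
lemma exists_subseq_tendsto_volume_symmDiff_of_perimeter_le {n : ℕ}
    {F : ℕ → Set (EuclideanSpace ℝ (Fin n))} {Ω : Set (EuclideanSpace ℝ (Fin n))}
    (hFm : ∀ j, MeasurableSet (F j)) {M C : ℝ≥0∞} (hM : M ≠ ∞) (hC : C ≠ ∞)
    (hFM : ∀ j, volume (F j) ≤ M) (hFC : ∀ j, perimeter (F j) ≤ C)
    (hΩ : volume Ω ≠ ∞) (hFΩ : Tendsto (fun j => volume (F j \ Ω)) atTop (𝓝 0)) :
    ∃ φ : ℕ → ℕ, StrictMono φ ∧ ∃ G, MeasurableSet G ∧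
      Tendsto (fun j => volume (F (φ j) ∆ G)) atTop (𝓝 0) := by
  obtain ⟨φ, hφ, hlim⟩ := exists_subseq_tendsto_measure_inter hFm hM hFM
  suffices ∀ ε : ℝ≥0∞, ε ≠ 0 → ∃ N, ∀ j ≥ N, ∀ k ≥ N, volume (F (φ j) \ F (φ k)) ≤ ε by
    obtain ⟨ψ, hψ, G, hG, h⟩ := exists_subseq_tendsto_measure_symmDiff (fun j => hFm (φ j)) this
    exact ⟨φ ∘ ψ, hφ.comp hψ, G, hG, h⟩
  intro ε hε
  have hε4 : 0 < ε / 4 := ENNReal.div_pos hε ENNReal.ofNat_ne_top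
  obtain ⟨r, hrε, hr⟩ : ∃ r : ℝ, ENNReal.ofReal r * C ≤ ε / 4 ∧ 0 < r := by
    have h1 : Tendsto (fun r : ℝ => ENNReal.ofReal r * C) (𝓝[>] 0) (𝓝 0) := by
      have h2 : Tendsto (fun r : ℝ => ENNReal.ofReal r) (𝓝[>] 0) (𝓝 0) := by
        simpa using (ENNReal.continuous_ofReal.tendsto 0).mono_left nhdsWithin_le_nhds
      simpa using ENNReal.Tendsto.mul_const h2 (Or.inr hC)
    exact ((h1.eventually_le_const hε4).and self_mem_nhdsWithin).exists
  set A := ball (0 : EuclideanSpace ℝ (Fin n)) r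
  have hA : MeasurableSet A := measurableSet_ball
  have hA0 : volume A ≠ 0 := (measure_ball_pos _ _ hr).ne'
  have hAt : volume A ≠ ∞ := measure_ball_lt_top.ne
  let m (j : ℕ) (x : EuclideanSpace ℝ (Fin n)) : ℝ≥0∞ := volume {y ∈ A | x + y ∈ F (φ j)}
  have hm (j) : Measurable (m j) := measurable_volume_sep (hFm _) hA
  have hmA (j x) : m j x ≤ volume A := measure_mono (sep_subset _ _)
  have hml (x) : ∃ l, Tendsto (fun j => m j x) atTop (𝓝 l) := by
    have hB : MeasurableSet ((fun z => -x + z) ⁻¹' A) := (measurable_const_add (-x)) hA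
    obtain ⟨l, hl⟩ := hlim _ hB (by rwa [measure_preimage_add])
    refine ⟨l, hl.congr fun j => ?_⟩
    rw [← measure_preimage_add volume x]
    congr 1
    ext y
    simp [and_comm]
  choose l hl using hml
  have hlm : Measurable l := measurable_of_tendsto_metrizable hm (tendsto_pi_nhds.2 hl)
  have hlA (x) : l x ≤ volume A := le_of_tendsto' (hl x) fun j => hmA j x
  have hlt (x) : l x ≠ ∞ := ne_top_of_le_ne_top hAt (hlA x)
  have hbd : ∫⁻ _ in Ω, volume A ≠ ∞ := by
    rw [setLIntegral_const]; exact ENNReal.mul_ne_top hAt hΩ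
  have hI : Tendsto (fun j => ∫⁻ x in Ω, (m j x - l x)) atTop (𝓝 0) := by
    simpa using tendsto_lintegral_of_dominated_convergence (μ := volume.restrict Ω)
      (F := fun j x => m j x - l x) (f := fun _ => 0) (fun _ => volume A)
      (fun j => (hm j).sub hlm) (fun j => .of_forall fun x => tsub_le_self.trans (hmA j x)) hbd
      (.of_forall fun x => by
        simpa using ENNReal.Tendsto.sub (hl x) (tendsto_const_nhds (x := l x)) (Or.inl (hlt x)))
  have hJ : Tendsto (fun j => ∫⁻ x in Ω, (l x - m j x)) atTop (𝓝 0) := by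
    simpa using tendsto_lintegral_of_dominated_convergence (μ := volume.restrict Ω)
      (F := fun j x => l x - m j x) (f := fun _ => 0) (fun _ => volume A)
      (fun j => hlm.sub (hm j)) (fun j => .of_forall fun x => tsub_le_self.trans (hlA x)) hbd
      (.of_forall fun x => by
        simpa using ENNReal.Tendsto.sub (tendsto_const_nhds (x := l x)) (hl x) (Or.inl (hlt x)))
  have hT : Tendsto (fun j => (∫⁻ x in Ω, (m j x - l x)) + volume A * volume (F (φ j) \ Ω))
      atTop (𝓝 0) := by
    simpa using hI.add
      (ENNReal.Tendsto.const_mul (hFΩ.comp hφ.tendsto_atTop) (Or.inr hAt) (a := volume A))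
  have hAε : 0 < volume A * (ε / 4) := ENNReal.mul_pos hA0 hε4.ne'
  obtain ⟨N, hN⟩ := eventually_atTop.1
    ((hT.eventually_le_const hAε).and (hJ.eventually_le_const hAε))
  refine ⟨N, fun j hj k hk => ?_⟩
  have hF (i) : volume (F i) ≠ ∞ := ne_top_of_le_ne_top hM (hFM i)
  have hP (i) : perimeter (F i) ≠ ∞ := ne_top_of_le_ne_top hC (hFC i)
  have hPε (i) : ENNReal.ofReal r * perimeter (F i) ≤ ε / 4 :=
    (mul_le_mul_right (hFC i) _).trans hrε
  have h_split : ∫⁻ x in F (φ j), (m j x - m k x) ≤ ((∫⁻ x in Ω, (m j x - l x)) +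
      volume A * volume (F (φ j) \ Ω)) + ∫⁻ x in Ω, (l x - m k x) := by
    calc ∫⁻ x in F (φ j), (m j x - m k x)
        ≤ ∫⁻ x in Ω ∪ F (φ j) \ Ω, (m j x - m k x) :=
          lintegral_mono_set fun x hx => by by_cases x ∈ Ω <;> simp_all
      _ ≤ (∫⁻ x in Ω, (m j x - m k x)) + ∫⁻ x in F (φ j) \ Ω, (m j x - m k x) :=
          lintegral_union_le _ _ _
      _ ≤ (∫⁻ x in Ω, ((m j x - l x) + (l x - m k x))) + ∫⁻ x in F (φ j) \ Ω, volume A :=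
          add_le_add (lintegral_mono fun x => tsub_le_tsub_add_tsub)
            (lintegral_mono fun x => tsub_le_self.trans (hmA j x))
      _ = _ := by
          have h := lintegral_add_left (μ := volume.restrict Ω) (f := fun x => m j x - l x)
            ((hm j).sub hlm) fun x => l x - m k x
          rw [h, setLIntegral_const]
          ring
  have key := volume_mul_volume_diff_le (hFm (φ j)) (hF _) (hP _) (hFm (φ k)) (hF _) (hP _) hA
    (r := r) fun y hy => (mem_ball_zero_iff.1 hy).le
  refine (ENNReal.mul_le_mul_iff_right hA0 hAt).1 (key.trans ?_)
  calc _ ≤ volume A * (ε / 4) + volume A * (ε / 4) + (volume A * (ε / 4) + volume A * (ε / 4)) := by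
        refine add_le_add (add_le_add ?_ ?_) (h_split.trans (add_le_add (hN j hj).1 (hN k hk).2))
        · gcongr; exact hPε _
        · gcongr; exact hPε _
    _ = volume A * (4 * (ε / 4)) := by ring
    _ = volume A * ε := by rw [ENNReal.mul_div_cancel (by simp) ENNReal.ofNat_ne_top]

lemma tendsto_setIntegral_of_tendsto_measure_symmDiff {α E : Type*} [MeasurableSpace α]
    [NormedAddCommGroup E] [NormedSpace ℝ E] {μ : Measure α} {f : α → E} (hf : Integrable f μ)
    {ι : Type*} {l : Filter ι} {F : ι → Set α} {G : Set α} (hFm : ∀ j, MeasurableSet (F j))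
    (hG : MeasurableSet G) (h : Tendsto (fun j => μ (F j ∆ G)) l (𝓝 0)) :
    Tendsto (fun j => ∫ x in F j, f x ∂μ) l (𝓝 (∫ x in G, f x ∂μ)) := by
  have h1 : Tendsto (fun j => ∫ x in F j \ G, f x ∂μ) l (𝓝 0) :=
    hf.tendsto_setIntegral_nhds_zero (tendsto_of_tendsto_of_tendsto_of_le_of_le tendsto_const_nhds
      h (fun _ => zero_le) fun j => measure_mono subset_union_left)
  have h2 : Tendsto (fun j => ∫ x in G \ F j, f x ∂μ) l (𝓝 0) :=
    hf.tendsto_setIntegral_nhds_zero (tendsto_of_tendsto_of_tendsto_of_le_of_le tendsto_const_nhds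
      h (fun _ => zero_le) fun j => measure_mono subset_union_right)
  have h3 := (h1.sub h2).const_add (∫ x in G, f x ∂μ)
  rw [sub_zero, add_zero] at h3
  refine h3.congr fun j => ?_
  rw [← integral_inter_add_sdiff (s := F j) hG hf.integrableOn,
    ← integral_inter_add_sdiff (s := G) (hFm j) hf.integrableOn, inter_comm]
  abel

lemma integrable_divergence {n : ℕ} {g : EuclideanSpace ℝ (Fin n) → EuclideanSpace ℝ (Fin n)}
    (hg : ContDiff ℝ 1 g) (hgc : HasCompactSupport g) : Integrable (divergence g) := by
  let T : (EuclideanSpace ℝ (Fin n) →L[ℝ] EuclideanSpace ℝ (Fin n)) →ₗ[ℝ] ℝ :=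
    (LinearMap.trace ℝ (EuclideanSpace ℝ (Fin n))).comp (ContinuousLinearMap.coeLM ℝ)
  have hT : Continuous T := T.continuous_of_finiteDimensional
  exact (hT.comp (hg.continuous_fderiv one_ne_zero)).integrable_of_hasCompactSupport
    ((hgc.fderiv (𝕜 := ℝ)).comp_left (map_zero T))

/-- Lower semicontinuity of the perimeter with respect to convergence in measure. -/
lemma perimeter_le_of_tendsto {n : ℕ} {F : ℕ → Set (EuclideanSpace ℝ (Fin n))}
    {G : Set (EuclideanSpace ℝ (Fin n))} (hFm : ∀ j, MeasurableSet (F j)) (hG : MeasurableSet G)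
    (h : Tendsto (fun j => volume (F j ∆ G)) atTop (𝓝 0)) {a : ℕ → ℝ≥0∞} {b : ℝ≥0∞}
    (ha : ∀ j, perimeter (F j) ≤ a j) (hab : Tendsto a atTop (𝓝 b)) : perimeter G ≤ b := by
  refine iSup₂_le fun g hg => ?_
  have h1 := tendsto_setIntegral_of_tendsto_measure_symmDiff
    (integrable_divergence hg.1 hg.2.1) hFm hG h
  refine le_of_tendsto_of_tendsto' (ENNReal.tendsto_ofReal h1) hab fun j => le_trans ?_ (ha j)
  exact le_iSup₂ (f := fun g (_ : g ∈ {g : EuclideanSpace ℝ (Fin n) → EuclideanSpace ℝ (Fin n) |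
    ContDiff ℝ 1 g ∧ HasCompactSupport g ∧ ∀ x, ‖g x‖ ≤ 1}) =>
    ENNReal.ofReal (∫ x in F j, divergence g x)) g hg

lemma tendsto_measure_of_tendsto_measure_symmDiff {α : Type*} [MeasurableSpace α] {μ : Measure α}
    {F : ℕ → Set α} {G : Set α} (hFm : ∀ j, MeasurableSet (F j)) (hG : MeasurableSet G)
    (h : Tendsto (fun j => μ (F j ∆ G)) atTop (𝓝 0)) :
    Tendsto (fun j => μ (F j)) atTop (𝓝 (μ G)) := by
  let F' (j : ℕ) : MeasuredSets μ := ⟨F j, hFm j⟩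
  let G' : MeasuredSets μ := ⟨G, hG⟩
  have h' : Tendsto F' atTop (𝓝 G') := tendsto_iff_edist_tendsto_0.2 h
  exact (MeasuredSets.continuous_measure.tendsto G').comp h'

/-- **Lower semicontinuity of the Cheeger constant.** Let `Ω` and `Ω_j` (`j ∈ ℕ`) be nonempty
bounded open subsets of `ℝⁿ` (`n ≥ 2`).  If `χ_{Ω_j} → χ_Ω` in `L¹(ℝⁿ)` (equivalently, the
volume of the symmetric differences `Ω_j ∆ Ω` tends to `0`), then
`liminf_j h(Ω_j) ≥ h(Ω)`. -/
theorem cheegerConstant_le_liminf {n : ℕ} (hn : 2 ≤ n)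
    (Ω : Set (EuclideanSpace ℝ (Fin n))) (Ωs : ℕ → Set (EuclideanSpace ℝ (Fin n)))
    (hΩne : Ω.Nonempty) (hΩop : IsOpen Ω) (hΩbd : Bornology.IsBounded Ω)
    (hne : ∀ j, (Ωs j).Nonempty) (hop : ∀ j, IsOpen (Ωs j))
    (hbd : ∀ j, Bornology.IsBounded (Ωs j))
    (hL1 : Tendsto (fun j => volume (symmDiff (Ωs j) Ω)) atTop (𝓝 0)) :
    cheegerConstant Ω ≤ Filter.liminf (fun j => cheegerConstant (Ωs j)) atTop := by
  by_contra! hlt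
  obtain ⟨c, hc1, hc2⟩ := exists_between hlt
  have hct : c ≠ ∞ := hc2.ne_top
  have hΩt : volume Ω ≠ ∞ := hΩbd.measure_lt_top.ne
  have hfreq := (frequently_lt_of_liminf_lt (h := hc1)).and_eventually
    (hL1.eventually_le_const one_pos)
  obtain ⟨φ, hφ, hφc⟩ := extraction_of_frequently_atTop hfreq
  have hex (j : ℕ) : ∃ F, MeasurableSet F ∧ F ⊆ Ωs (φ j) ∧ 0 < volume F ∧
      perimeter F ≤ c * volume F := by
    obtain ⟨F, ⟨hF1, hF2, hF3⟩, hF4⟩ := by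
      simpa only [cheegerConstant, iInf_lt_iff, exists_prop] using (hφc j).1
    refine ⟨F, hF1, hF2, hF3, ?_⟩
    have hFt : volume F ≠ ∞ := measure_ne_top_of_subset hF2 (hbd _).measure_lt_top.ne
    exact (ENNReal.div_le_iff hF3.ne' hFt).1 hF4.le
  choose F hFm hFΩ hF0 hFc using hex
  have hFdiff (j) : F j \ Ω ⊆ symmDiff (Ωs (φ j)) Ω := fun x hx => Or.inl ⟨hFΩ j hx.1, hx.2⟩
  have hFΩ0 : Tendsto (fun j => volume (F j \ Ω)) atTop (𝓝 0) :=
    tendsto_of_tendsto_of_tendsto_of_le_of_le tendsto_const_nhds (hL1.comp hφ.tendsto_atTop)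
      (fun _ => zero_le) fun j => measure_mono (hFdiff j)
  have hM : volume Ω + 1 ≠ ∞ := ENNReal.add_ne_top.2 ⟨hΩt, ENNReal.one_ne_top⟩
  have hFM (j) : volume (F j) ≤ volume Ω + 1 := by
    calc volume (F j) ≤ volume (Ω ∪ F j \ Ω) := measure_mono (by simp)
      _ ≤ volume Ω + volume (F j \ Ω) := measure_union_le _ _
      _ ≤ volume Ω + 1 := by
          gcongr; exact (measure_mono (hFdiff j)).trans (hφc j).2
  have hPC (j) : perimeter (F j) ≤ c * (volume Ω + 1) := (hFc j).trans (by gcongr; exact hFM j)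
  have hCt : c * (volume Ω + 1) ≠ ∞ := ENNReal.mul_ne_top hct hM
  obtain ⟨ψ, hψ, G, hGm, hG⟩ := exists_subseq_tendsto_volume_symmDiff_of_perimeter_le hFm hM hCt
    hFM hPC hΩt hFΩ0
  have hGΩ : volume (G \ Ω) = 0 := by
    have h1 := hG.add (hFΩ0.comp hψ.tendsto_atTop)
    rw [add_zero] at h1
    refine le_antisymm (ge_of_tendsto' h1 fun j => ?_) zero_le
    refine (measure_mono fun x hx => ?_).trans (measure_union_le _ _)
    by_cases hxF : x ∈ F (ψ j)
    · exact Or.inr ⟨hxF, hx.2⟩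
    · exact Or.inl (Or.inr ⟨hx.1, hxF⟩)
  have hHm : MeasurableSet (G ∩ Ω) := hGm.inter hΩop.measurableSet
  have hH : Tendsto (fun j => volume (F (ψ j) ∆ (G ∩ Ω))) atTop (𝓝 0) := by
    refine hG.congr fun j => measure_congr ?_
    have : (G ∩ Ω : Set _) =ᵐ[volume] G := by
      rw [← sdiff_sdiff_right_self]
      exact sdiff_null_ae_eq_self hGΩ
    exact (ae_eq_refl _).symmDiff this.symm
  have hvol := tendsto_measure_of_tendsto_measure_symmDiff (fun j => hFm (ψ j)) hHm hH
  have hHt : volume (G ∩ Ω) ≠ ∞ := measure_ne_top_of_subset inter_subset_right hΩt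
  have hPH : perimeter (G ∩ Ω) ≤ c * volume (G ∩ Ω) :=
    perimeter_le_of_tendsto (fun j => hFm (ψ j)) hHm hH (fun j => hFc (ψ j))
      (ENNReal.Tendsto.const_mul hvol (Or.inr hct))
  have hHpos : 0 < volume (G ∩ Ω) := by
    obtain ⟨r, hr, hrc⟩ : ∃ r : ℝ, 0 < r ∧ 2 * (ENNReal.ofReal r * c) < 1 := by
      have h1 : Tendsto (fun r : ℝ => 2 * (ENNReal.ofReal r * c)) (𝓝[>] 0) (𝓝 0) := by
        have h2 : Tendsto (fun r : ℝ => ENNReal.ofReal r) (𝓝[>] 0) (𝓝 0) := by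
          simpa using (ENNReal.continuous_ofReal.tendsto 0).mono_left nhdsWithin_le_nhds
        simpa using ENNReal.Tendsto.const_mul (ENNReal.Tendsto.mul_const h2 (Or.inr hct))
          (Or.inr ENNReal.ofNat_ne_top) (a := 2)
      exact ((eventually_mem_nhdsWithin).and (h1.eventually_lt_const one_pos)).exists
    refine lt_of_lt_of_le (ENNReal.half_pos (measure_ball_pos volume
      (0 : EuclideanSpace ℝ (Fin n)) hr).ne') (ge_of_tendsto' hvol fun j => ?_)
    by_contra! hlt
    have h1 := volume_le_mul_perimeter (hFm (ψ j)) (ne_top_of_le_ne_top hCt (hPC _)) hr hlt.le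
    have hFt : volume (F (ψ j)) ≠ ∞ := ne_top_of_le_ne_top hM (hFM _)
    have h2 : volume (F (ψ j)) < volume (F (ψ j)) := by
      calc volume (F (ψ j)) ≤ 2 * (ENNReal.ofReal r * (c * volume (F (ψ j)))) :=
            h1.trans (by gcongr; exact hFc _)
        _ = 2 * (ENNReal.ofReal r * c) * volume (F (ψ j)) := by ring
        _ < 1 * volume (F (ψ j)) := ENNReal.mul_lt_mul_left (hF0 _).ne' hFt hrc
        _ = volume (F (ψ j)) := one_mul _
    exact h2.false
  have hle : cheegerConstant Ω ≤ perimeter (G ∩ Ω) / volume (G ∩ Ω) :=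
    iInf₂_le (G ∩ Ω) ⟨hHm, inter_subset_right, hHpos⟩
  exact (hle.trans ((ENNReal.div_le_iff hHpos.ne' hHt).2 hPH)).not_gt hc2
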